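/- Let p, q ∈ ℕ, let a_1,…,a_p > 0, b_1,…,b_q > 0, A_1,…,A_p > 0, B_1,…,B_q > 0 be real numbers, and suppose Υ = Σ_{r=1}^q B_r − Σ_{l=1}^p A_l > −1. Then the function z ↦ Σ_{k=0}^∞ c_k z^k is analytic on all of ℂ (the Fox–Wright function is entire). -/

import Mathlib

open scoped BigOperators

open Filter Topology in
/-- `log (s + k A) - log k` tends to `log A`. -/
theorem tendsto_log_add_nat_mul_sub_log (s : ℝ) {A : ℝ} (hA : 0 < A) :
    Tendsto (fun k : ℕ => Real.log (s + k * A) - Real.log k) atTop (𝓝 (Real.log A)) := by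
  have hkA : Tendsto (fun k : ℕ => (k : ℝ) * A) atTop atTop :=
    tendsto_natCast_atTop_atTop.atTop_mul_const hA
  have h := ((Real.tendsto_log_comp_add_sub_log s).comp hkA).add_const (Real.log A)
  rw [zero_add] at h
  refine h.congr' ?_
  filter_upwards [eventually_gt_atTop 0] with k hk
  have hk' : (0 : ℝ) < k := Nat.cast_pos.mpr hk
  simp only [Function.comp_apply]
  rw [Real.log_mul hk'.ne' hA.ne', add_comm s]
  ring

/-- Recurrence of the Gamma function in logarithmic form. -/
theorem log_Gamma_add_one_sub_log_Gamma {x : ℝ} (hx : 0 < x) :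
    Real.log (Real.Gamma (x + 1)) - Real.log (Real.Gamma x) = Real.log x := by
  rw [Real.Gamma_add_one hx.ne', Real.log_mul hx.ne' (Real.Gamma_pos_of_pos hx).ne']
  ring

/-- Increments of `log Γ` are bounded above by log-convexity. -/
theorem log_Gamma_add_sub_le {x A : ℝ} (hx : 0 < x) (hA : 0 < A) :
    Real.log (Real.Gamma (x + A)) - Real.log (Real.Gamma x) ≤ A * Real.log (x + A) := by
  have h := Real.convexOn_log_Gamma.slope_mono_adjacent (x := x) (y := x + A) (z := x + A + 1)
    (Set.mem_Ioi.mpr hx) (Set.mem_Ioi.mpr (by linarith)) (by linarith) (by linarith)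
  simp only [Function.comp_apply, add_sub_cancel_left, div_one] at h
  rw [log_Gamma_add_one_sub_log_Gamma (by linarith), div_le_iff₀ hA] at h
  linarith

/-- Increments of `log Γ` are bounded below by log-convexity. -/
theorem mul_log_le_log_Gamma_add_sub {x A : ℝ} (hx : 1 < x) (hA : 0 < A) :
    A * Real.log (x - 1) ≤ Real.log (Real.Gamma (x + A)) - Real.log (Real.Gamma x) := by
  have h := Real.convexOn_log_Gamma.slope_mono_adjacent (x := x - 1) (y := x) (z := x + A)
    (Set.mem_Ioi.mpr (by linarith)) (Set.mem_Ioi.mpr (by linarith)) (by linarith) (by linarith)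
  have h1 := log_Gamma_add_one_sub_log_Gamma (x := x - 1) (by linarith)
  simp only [Function.comp_apply, add_sub_cancel_left, sub_sub_cancel, div_one] at h
  rw [sub_add_cancel] at h1
  rw [h1, le_div_iff₀ hA] at h
  linarith

open Filter Topology in
/-- The increment of `log Γ` along an arithmetic progression of step `A` is
`A log k + A log A + o(1)`. -/
theorem tendsto_log_Gamma_increment_sub (a : ℝ) {A : ℝ} (hA : 0 < A) :
    Tendsto (fun k : ℕ => Real.log (Real.Gamma (a + ((k + 1 : ℕ) : ℝ) * A)) -
      Real.log (Real.Gamma (a + k * A)) - A * Real.log k) atTop (𝓝 (A * Real.log A)) := by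
  have hlarge : ∀ᶠ k : ℕ in atTop, 1 < a + (k : ℝ) * A :=
    (tendsto_atTop_add_const_left _ a
      (tendsto_natCast_atTop_atTop.atTop_mul_const hA)).eventually_gt_atTop 1
  have heq (k : ℕ) : a + ((k + 1 : ℕ) : ℝ) * A = a + k * A + A := by
    push_cast
    ring
  refine tendsto_of_tendsto_of_tendsto_of_le_of_le'
    ((tendsto_log_add_nat_mul_sub_log (a - 1) hA).const_mul A)
    ((tendsto_log_add_nat_mul_sub_log (a + A) hA).const_mul A) ?_ ?_
  · filter_upwards [hlarge] with k hk
    have h := mul_log_le_log_Gamma_add_sub hk hA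
    rw [heq, mul_sub, sub_add_eq_add_sub a 1]
    linarith
  · filter_upwards [hlarge] with k hk
    have h := log_Gamma_add_sub_le (by linarith : 0 < a + (k : ℝ) * A) hA
    rw [heq, mul_sub, add_right_comm a A]
    linarith

open Filter Topology in
/-- A positive sequence whose logarithmic increments tend to `-∞` has ratios tending to `0`. -/
theorem tendsto_div_zero_of_log_sub_atBot {c : ℕ → ℝ} (hc : ∀ k, 0 < c k)
    (h : Tendsto (fun k => Real.log (c (k + 1)) - Real.log (c k)) atTop atBot) :
    Tendsto (fun k => c (k + 1) / c k) atTop (𝓝 0) := by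
  refine (Real.tendsto_exp_atBot.comp h).congr fun k => ?_
  rw [Function.comp_apply, Real.exp_sub, Real.exp_log (hc _), Real.exp_log (hc _)]

open Filter Topology in
/-- A complex power series whose coefficient ratios tend to `0` is entire. -/
theorem analyticOnNhd_tsum_of_tendsto_ratio_zero {c : ℕ → ℂ} (hc : ∀ k, c k ≠ 0)
    (h : Tendsto (fun k => ‖c (k + 1)‖ / ‖c k‖) atTop (𝓝 0)) :
    AnalyticOnNhd ℂ (fun z : ℂ => ∑' k : ℕ, c k * z ^ k) Set.univ := by
  have hr : (FormalMultilinearSeries.ofScalars ℂ c).radius = ⊤ :=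
    FormalMultilinearSeries.ofScalars_radius_eq_top_of_tendsto ℂ c (.of_forall hc) h
  have hs := (FormalMultilinearSeries.ofScalars ℂ c).hasFPowerSeriesOnBall (by simp [hr])
  have han := hs.analyticOnNhd
  rw [hr, Metric.eball_top] at han
  convert han using 1
  exact (FormalMultilinearSeries.ofScalarsSum_eq_tsum c (E := ℂ)).symm

/-- If Υ = Σ B_r − Σ A_l > −1, the Fox–Wright function
z ↦ Σ c_k z^k is entire (analytic on all of ℂ). -/
theorem foxWright_entire_of_upsilon_gt_neg_one
    (p q : ℕ) (a A : Fin p → ℝ) (b B : Fin q → ℝ)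
    (ha : ∀ l, 0 < a l) (hb : ∀ r, 0 < b r)
    (hA : ∀ l, 0 < A l) (hB : ∀ r, 0 < B r)
    (c : ℕ → ℝ)
    (hc : ∀ k : ℕ, c k =
      (∏ l, Real.Gamma (a l + (k : ℝ) * A l)) /
        ((∏ r, Real.Gamma (b r + (k : ℝ) * B r)) * (Nat.factorial k : ℝ)))
    (hΥ : -1 < (∑ r, B r) - (∑ l, A l)) :
    AnalyticOnNhd ℂ (fun z : ℂ => ∑' k : ℕ, (c k : ℂ) * z ^ k) Set.univ := by
  have hΓa (k : ℕ) (l : Fin p) : 0 < Real.Gamma (a l + (k : ℝ) * A l) :=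
    Real.Gamma_pos_of_pos (add_pos_of_pos_of_nonneg (ha l) (by have := hA l; positivity))
  have hΓb (k : ℕ) (r : Fin q) : 0 < Real.Gamma (b r + (k : ℝ) * B r) :=
    Real.Gamma_pos_of_pos (add_pos_of_pos_of_nonneg (hb r) (by have := hB r; positivity))
  have hnum (k : ℕ) := Finset.prod_pos fun l (_ : l ∈ Finset.univ) => hΓa k l
  have hden (k : ℕ) := Finset.prod_pos fun r (_ : r ∈ Finset.univ) => hΓb k r
  have hfac (k : ℕ) : (0 : ℝ) < (Nat.factorial k : ℝ) := Nat.cast_pos.mpr k.factorial_pos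
  have hpos (k : ℕ) : 0 < c k := by
    rw [hc]
    exact div_pos (hnum k) (mul_pos (hden k) (hfac k))
  have hlog (k : ℕ) : Real.log (c k) = ∑ l, Real.log (Real.Gamma (a l + (k : ℝ) * A l)) -
      (∑ r, Real.log (Real.Gamma (b r + (k : ℝ) * B r)) + Real.log (Nat.factorial k)) := by
    rw [hc, Real.log_div (hnum k).ne' (mul_pos (hden k) (hfac k)).ne',
      Real.log_mul (hden k).ne' (hfac k).ne', Real.log_prod fun l _ => (hΓa k l).ne',
      Real.log_prod fun r _ => (hΓb k r).ne']
  have hfac_succ (k : ℕ) : Real.log (Nat.factorial (k + 1)) =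
      Real.log ((k : ℝ) + 1) + Real.log (Nat.factorial k) := by
    rw [Nat.factorial_succ, Nat.cast_mul, Real.log_mul (by positivity) (hfac k).ne']
    push_cast
    rfl
  have hlim := ((tendsto_finsetSum Finset.univ fun l _ =>
      tendsto_log_Gamma_increment_sub (a l) (hA l)).sub
    (tendsto_finsetSum Finset.univ fun r _ =>
      tendsto_log_Gamma_increment_sub (b r) (hB r))).sub Real.tendsto_log_nat_add_one_sub_log
  have hmain : Filter.Tendsto
      (fun k : ℕ => ((∑ l, A l) - (∑ r, B r) - 1) * Real.log k) Filter.atTop Filter.atBot :=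
    (Real.tendsto_log_atTop.comp tendsto_natCast_atTop_atTop).const_mul_atTop_of_neg
      (by linarith)
  have hratio := tendsto_div_zero_of_log_sub_atBot hpos <|
    (hmain.atBot_add hlim).congr fun k => by
      rw [hlog, hlog, hfac_succ]
      simp only [Finset.sum_sub_distrib, ← Finset.sum_mul]
      ring
  refine analyticOnNhd_tsum_of_tendsto_ratio_zero
    (fun k => Complex.ofReal_ne_zero.mpr (hpos k).ne') (hratio.congr fun k => ?_)
  rw [Complex.norm_of_nonneg (hpos _).le, Complex.norm_of_nonneg (hpos _).le]
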